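/- arXiv:1210.3829 — 2 statements merged into one kernel-verified Lean document; each statement's English description precedes it below -/
import Mathlib

section
/- Qgap(7) = 217070; that is, N = 217070 starts a squarefree gap of length exactly 7 (the seven consecutive integers 217070, …, 217076 are not squarefree while 217069 and 217077 are squarefree), and 217070 is the least positive integer starting a squarefree gap of length exactly 7. -/
/-- `N` starts a squarefree gap of length exactly `L`: none of the `L` consecutive
integers `N, N+1, …, N+L-1` is squarefree, while both `N-1` and `N+L` are squarefree. -/
def StartsSquarefreeGap (N L : ℕ) : Prop :=
  2 ≤ N ∧ 1 ≤ L ∧ (∀ i < L, ¬ Squarefree (N + i)) ∧ Squarefree (N - 1) ∧ Squarefree (N + L)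

/-- Bit mask whose bits at `0, d, 2d, …, (2^j - 1) d` are set. -/
def gapRep (d : ℕ) : ℕ → ℕ
  | 0 => 1
  | j + 1 => gapRep d j ||| (gapRep d j <<< (d * 2 ^ j))

theorem gapRep_testBit (d j q : ℕ) (h : q < 2 ^ j) : (gapRep d j).testBit (d * q) = true := by
  induction j generalizing q with
  | zero =>
    have : q = 0 := by simpa using h
    subst this
    simp [gapRep]
  | succ j ih =>
    rw [gapRep, Nat.testBit_or]
    by_cases hq : q < 2 ^ j
    · rw [ih q hq]; rfl
    · have hq' : 2 ^ j ≤ q := Nat.le_of_not_lt hq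
      have h2 : q - 2 ^ j < 2 ^ j := by rw [pow_succ] at h; omega
      have h3 := ih _ h2
      rw [Nat.mul_sub] at h3
      rw [Nat.testBit_shiftLeft, h3]
      simp [Nat.mul_le_mul_left d hq']

/-- Union of the masks of the squares `2^2, …, (m+1)^2`. -/
def gapMask : ℕ → ℕ
  | 0 => 0
  | m + 1 => gapMask m |||
      gapRep ((m + 2) * (m + 2)) (Nat.log2 (217077 / ((m + 2) * (m + 2))) + 1)

theorem gapMask_testBit (m k i : ℕ) (hk : 2 ≤ k) (hkm : k ≤ m + 1) (hd : k * k ∣ i)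
    (hi : i ≤ 217077) : (gapMask m).testBit i = true := by
  induction m with
  | zero => omega
  | succ m ih =>
    rw [gapMask, Nat.testBit_or]
    by_cases h : k ≤ m + 1
    · rw [ih h]; rfl
    · have : k = m + 2 := by omega
      subst this
      obtain ⟨q, rfl⟩ := hd
      rw [gapRep_testBit, Bool.or_true]
      refine lt_of_le_of_lt ?_ Nat.lt_log2_self
      rw [Nat.le_div_iff_mul_le (by positivity), mul_comm]
      exact hi

theorem gapMask_of_not_squarefree (i : ℕ) (hi : i < 217077) (h0 : 0 < i)
    (h : ¬ Squarefree i) : (gapMask 464).testBit i = true := by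
  rw [Nat.squarefree_iff_prime_squarefree] at h
  push Not at h
  obtain ⟨p, hp, hd⟩ := h
  refine gapMask_testBit _ p i hp.two_le ?_ hd (by omega)
  have := Nat.le_of_dvd h0 hd
  by_contra hc
  nlinarith

/-- Positions where seven consecutive bits are set. -/
def gapRuns (M : ℕ) : ℕ :=
  (M &&& (M >>> 1) &&& (M >>> 2) &&& (M >>> 3) &&& (M >>> 4) &&& (M >>> 5) &&& (M >>> 6))
    % 2 ^ 217070

theorem gapRuns_zero : gapRuns (gapMask 464) = 0 := by
  decide +kernel

theorem gap_nonsq (p n : ℕ) (hp : 2 ≤ p) (hd : p * p ∣ n) : ¬ Squarefree n := fun h => by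
  have := Nat.isUnit_iff.1 (h p hd)
  omega

theorem gap_sq (n : ℕ) (h0 : 0 < n) (hn : n < 217156)
    (h : ∀ k < 466, 2 ≤ k → ¬ k * k ∣ n) : Squarefree n := by
  rw [Nat.squarefree_iff_prime_squarefree]
  intro p hp hd
  have := Nat.le_of_dvd h0 hd
  refine h p ?_ hp.two_le hd
  by_contra hc
  nlinarith

/-- Qgap(7) = 217070. -/
theorem qgap_7 : IsLeast {N : ℕ | StartsSquarefreeGap N 7} 217070 := by
  constructor
  · refine ⟨by norm_num, by norm_num, ?_,
      gap_sq _ (by norm_num) (by norm_num) (by decide +kernel),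
      gap_sq _ (by norm_num) (by norm_num) (by decide +kernel)⟩
    intro i hi
    have key : ∀ i < 7, ∃ p < 600, 2 ≤ p ∧ p * p ∣ 217070 + i := by decide +kernel
    obtain ⟨p, -, hp, hd⟩ := key i hi
    exact gap_nonsq p _ hp hd
  · rintro N ⟨h2, -, h, -, -⟩
    by_contra hN
    have hN' : N < 217070 := by omega
    have hb : ∀ i < 7, (gapMask 464).testBit (N + i) = true := fun i hi =>
      gapMask_of_not_squarefree _ (by omega) (by omega) (h i hi)
    have hz : (gapRuns (gapMask 464)).testBit N = true := by
      generalize gapMask 464 = M at hb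
      have b0 := hb 0 (by omega)
      have b1 := hb 1 (by omega)
      have b2 := hb 2 (by omega)
      have b3 := hb 3 (by omega)
      have b4 := hb 4 (by omega)
      have b5 := hb 5 (by omega)
      have b6 := hb 6 (by omega)
      rw [add_comm] at b0 b1 b2 b3 b4 b5 b6
      rw [zero_add] at b0
      unfold gapRuns
      rw [Nat.testBit_mod_two_pow]
      simp only [Nat.testBit_and, Nat.testBit_shiftRight, b0, b1, b2, b3, b4, b5, b6, hN',
        decide_true, Bool.and_self]
    rw [gapRuns_zero, Nat.zero_testBit] at hz
    exact absurd hz (by decide)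
end

section
/- Qgap(11) = 221167422; that is, N = 221167422 starts a squarefree gap of length exactly 11 (the eleven consecutive integers 221167422, …, 221167432 are not squarefree while 221167421 and 221167433 are squarefree), and 221167422 is the least positive integer starting a squarefree gap of length exactly 11. -/
/-- Evaluate `n` to a literal before passing it on to `f`. -/
noncomputable def force (n : ℕ) (f : ℕ → ℕ) : ℕ :=
  Nat.rec (f 0) (fun m _ => f (Nat.succ m)) n

theorem force_eq (n : ℕ) (f : ℕ → ℕ) : force n f = f n := by
  cases n <;> rfl

/-- Repeat a bit pattern `h` of width `w` by doubling, until it has width at least `len`. -/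
noncomputable def rep (len fuel : ℕ) : ℕ → ℕ → ℕ :=
  Nat.rec (fun h _ => h)
    (fun _ ih h w => Bool.rec
      (force (Nat.lor h (Nat.shiftLeft h w)) (fun h' => ih h' (Nat.add w w)))
      h (Nat.ble len w)) fuel

/-- Offset of the first multiple of `s` that is at least `lo`. -/
def off (lo s : ℕ) : ℕ := Nat.mod (Nat.sub s (Nat.mod lo s)) s

/-- Bit mask of the numbers `lo + j`, `j < len`, divisible by the square of a member of the list. -/
noncomputable def sieve (lo len : ℕ) (l : List ℕ) : ℕ :=
  List.rec 0 (fun p _ ih => Bool.rec ih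
    (Nat.lor (Nat.shiftLeft (rep len 24 1 (Nat.mul p p)) (off lo (Nat.mul p p))) ih)
    (Nat.blt (off lo (Nat.mul p p)) len)) l

/-- Keep the bits that start a run of eleven ones. -/
noncomputable def runs (S : ℕ) : ℕ :=
  force S fun S => force (Nat.land S (Nat.shiftRight S 1)) fun A =>
  force (Nat.land A (Nat.shiftRight A 2)) fun B =>
  force (Nat.land B (Nat.shiftRight B 4)) fun C =>
  Nat.land C (Nat.shiftRight C 3)

/-- Combine the sieves of several lists (to keep the recursion shallow). -/
noncomputable def sieveAll (lo len : ℕ) (ll : List (List ℕ)) : ℕ :=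
  List.rec 0 (fun l _ ih => Nat.lor (sieve lo len l) ih) ll

/-- All primes up to 14880, in chunks. -/
def primeLists : List (List ℕ) := [
  [2, 3, 5, 7, 11, 13, 17, 19, 23, 29, 31, 37, 41, 43, 47, 53,
   59, 61, 67, 71, 73, 79, 83, 89, 97, 101, 103, 107, 109, 113, 127, 131,
   137, 139, 149, 151, 157, 163, 167, 173, 179, 181, 191, 193, 197, 199, 211, 223,
   227, 229, 233, 239, 241, 251, 257, 263, 269, 271, 277, 281, 283, 293, 307, 311],
  [313, 317, 331, 337, 347, 349, 353, 359, 367, 373, 379, 383, 389, 397, 401, 409,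
   419, 421, 431, 433, 439, 443, 449, 457, 461, 463, 467, 479, 487, 491, 499, 503,
   509, 521, 523, 541, 547, 557, 563, 569, 571, 577, 587, 593, 599, 601, 607, 613,
   617, 619, 631, 641, 643, 647, 653, 659, 661, 673, 677, 683, 691, 701, 709, 719],
  [727, 733, 739, 743, 751, 757, 761, 769, 773, 787, 797, 809, 811, 821, 823, 827,
   829, 839, 853, 857, 859, 863, 877, 881, 883, 887, 907, 911, 919, 929, 937, 941,
   947, 953, 967, 971, 977, 983, 991, 997, 1009, 1013, 1019, 1021, 1031, 1033, 1039, 1049,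
   1051, 1061, 1063, 1069, 1087, 1091, 1093, 1097, 1103, 1109, 1117, 1123, 1129, 1151, 1153, 1163],
  [1171, 1181, 1187, 1193, 1201, 1213, 1217, 1223, 1229, 1231, 1237, 1249, 1259, 1277, 1279, 1283,
   1289, 1291, 1297, 1301, 1303, 1307, 1319, 1321, 1327, 1361, 1367, 1373, 1381, 1399, 1409, 1423,
   1427, 1429, 1433, 1439, 1447, 1451, 1453, 1459, 1471, 1481, 1483, 1487, 1489, 1493, 1499, 1511,
   1523, 1531, 1543, 1549, 1553, 1559, 1567, 1571, 1579, 1583, 1597, 1601, 1607, 1609, 1613, 1619],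
  [1621, 1627, 1637, 1657, 1663, 1667, 1669, 1693, 1697, 1699, 1709, 1721, 1723, 1733, 1741, 1747,
   1753, 1759, 1777, 1783, 1787, 1789, 1801, 1811, 1823, 1831, 1847, 1861, 1867, 1871, 1873, 1877,
   1879, 1889, 1901, 1907, 1913, 1931, 1933, 1949, 1951, 1973, 1979, 1987, 1993, 1997, 1999, 2003,
   2011, 2017, 2027, 2029, 2039, 2053, 2063, 2069, 2081, 2083, 2087, 2089, 2099, 2111, 2113, 2129],
  [2131, 2137, 2141, 2143, 2153, 2161, 2179, 2203, 2207, 2213, 2221, 2237, 2239, 2243, 2251, 2267,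
   2269, 2273, 2281, 2287, 2293, 2297, 2309, 2311, 2333, 2339, 2341, 2347, 2351, 2357, 2371, 2377,
   2381, 2383, 2389, 2393, 2399, 2411, 2417, 2423, 2437, 2441, 2447, 2459, 2467, 2473, 2477, 2503,
   2521, 2531, 2539, 2543, 2549, 2551, 2557, 2579, 2591, 2593, 2609, 2617, 2621, 2633, 2647, 2657],
  [2659, 2663, 2671, 2677, 2683, 2687, 2689, 2693, 2699, 2707, 2711, 2713, 2719, 2729, 2731, 2741,
   2749, 2753, 2767, 2777, 2789, 2791, 2797, 2801, 2803, 2819, 2833, 2837, 2843, 2851, 2857, 2861,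
   2879, 2887, 2897, 2903, 2909, 2917, 2927, 2939, 2953, 2957, 2963, 2969, 2971, 2999, 3001, 3011,
   3019, 3023, 3037, 3041, 3049, 3061, 3067, 3079, 3083, 3089, 3109, 3119, 3121, 3137, 3163, 3167],
  [3169, 3181, 3187, 3191, 3203, 3209, 3217, 3221, 3229, 3251, 3253, 3257, 3259, 3271, 3299, 3301,
   3307, 3313, 3319, 3323, 3329, 3331, 3343, 3347, 3359, 3361, 3371, 3373, 3389, 3391, 3407, 3413,
   3433, 3449, 3457, 3461, 3463, 3467, 3469, 3491, 3499, 3511, 3517, 3527, 3529, 3533, 3539, 3541,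
   3547, 3557, 3559, 3571, 3581, 3583, 3593, 3607, 3613, 3617, 3623, 3631, 3637, 3643, 3659, 3671],
  [3673, 3677, 3691, 3697, 3701, 3709, 3719, 3727, 3733, 3739, 3761, 3767, 3769, 3779, 3793, 3797,
   3803, 3821, 3823, 3833, 3847, 3851, 3853, 3863, 3877, 3881, 3889, 3907, 3911, 3917, 3919, 3923,
   3929, 3931, 3943, 3947, 3967, 3989, 4001, 4003, 4007, 4013, 4019, 4021, 4027, 4049, 4051, 4057,
   4073, 4079, 4091, 4093, 4099, 4111, 4127, 4129, 4133, 4139, 4153, 4157, 4159, 4177, 4201, 4211],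
  [4217, 4219, 4229, 4231, 4241, 4243, 4253, 4259, 4261, 4271, 4273, 4283, 4289, 4297, 4327, 4337,
   4339, 4349, 4357, 4363, 4373, 4391, 4397, 4409, 4421, 4423, 4441, 4447, 4451, 4457, 4463, 4481,
   4483, 4493, 4507, 4513, 4517, 4519, 4523, 4547, 4549, 4561, 4567, 4583, 4591, 4597, 4603, 4621,
   4637, 4639, 4643, 4649, 4651, 4657, 4663, 4673, 4679, 4691, 4703, 4721, 4723, 4729, 4733, 4751],
  [4759, 4783, 4787, 4789, 4793, 4799, 4801, 4813, 4817, 4831, 4861, 4871, 4877, 4889, 4903, 4909,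
   4919, 4931, 4933, 4937, 4943, 4951, 4957, 4967, 4969, 4973, 4987, 4993, 4999, 5003, 5009, 5011,
   5021, 5023, 5039, 5051, 5059, 5077, 5081, 5087, 5099, 5101, 5107, 5113, 5119, 5147, 5153, 5167,
   5171, 5179, 5189, 5197, 5209, 5227, 5231, 5233, 5237, 5261, 5273, 5279, 5281, 5297, 5303, 5309],
  [5323, 5333, 5347, 5351, 5381, 5387, 5393, 5399, 5407, 5413, 5417, 5419, 5431, 5437, 5441, 5443,
   5449, 5471, 5477, 5479, 5483, 5501, 5503, 5507, 5519, 5521, 5527, 5531, 5557, 5563, 5569, 5573,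
   5581, 5591, 5623, 5639, 5641, 5647, 5651, 5653, 5657, 5659, 5669, 5683, 5689, 5693, 5701, 5711,
   5717, 5737, 5741, 5743, 5749, 5779, 5783, 5791, 5801, 5807, 5813, 5821, 5827, 5839, 5843, 5849],
  [5851, 5857, 5861, 5867, 5869, 5879, 5881, 5897, 5903, 5923, 5927, 5939, 5953, 5981, 5987, 6007,
   6011, 6029, 6037, 6043, 6047, 6053, 6067, 6073, 6079, 6089, 6091, 6101, 6113, 6121, 6131, 6133,
   6143, 6151, 6163, 6173, 6197, 6199, 6203, 6211, 6217, 6221, 6229, 6247, 6257, 6263, 6269, 6271,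
   6277, 6287, 6299, 6301, 6311, 6317, 6323, 6329, 6337, 6343, 6353, 6359, 6361, 6367, 6373, 6379],
  [6389, 6397, 6421, 6427, 6449, 6451, 6469, 6473, 6481, 6491, 6521, 6529, 6547, 6551, 6553, 6563,
   6569, 6571, 6577, 6581, 6599, 6607, 6619, 6637, 6653, 6659, 6661, 6673, 6679, 6689, 6691, 6701,
   6703, 6709, 6719, 6733, 6737, 6761, 6763, 6779, 6781, 6791, 6793, 6803, 6823, 6827, 6829, 6833,
   6841, 6857, 6863, 6869, 6871, 6883, 6899, 6907, 6911, 6917, 6947, 6949, 6959, 6961, 6967, 6971],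
  [6977, 6983, 6991, 6997, 7001, 7013, 7019, 7027, 7039, 7043, 7057, 7069, 7079, 7103, 7109, 7121,
   7127, 7129, 7151, 7159, 7177, 7187, 7193, 7207, 7211, 7213, 7219, 7229, 7237, 7243, 7247, 7253,
   7283, 7297, 7307, 7309, 7321, 7331, 7333, 7349, 7351, 7369, 7393, 7411, 7417, 7433, 7451, 7457,
   7459, 7477, 7481, 7487, 7489, 7499, 7507, 7517, 7523, 7529, 7537, 7541, 7547, 7549, 7559, 7561],
  [7573, 7577, 7583, 7589, 7591, 7603, 7607, 7621, 7639, 7643, 7649, 7669, 7673, 7681, 7687, 7691,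
   7699, 7703, 7717, 7723, 7727, 7741, 7753, 7757, 7759, 7789, 7793, 7817, 7823, 7829, 7841, 7853,
   7867, 7873, 7877, 7879, 7883, 7901, 7907, 7919, 7927, 7933, 7937, 7949, 7951, 7963, 7993, 8009,
   8011, 8017, 8039, 8053, 8059, 8069, 8081, 8087, 8089, 8093, 8101, 8111, 8117, 8123, 8147, 8161],
  [8167, 8171, 8179, 8191, 8209, 8219, 8221, 8231, 8233, 8237, 8243, 8263, 8269, 8273, 8287, 8291,
   8293, 8297, 8311, 8317, 8329, 8353, 8363, 8369, 8377, 8387, 8389, 8419, 8423, 8429, 8431, 8443,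
   8447, 8461, 8467, 8501, 8513, 8521, 8527, 8537, 8539, 8543, 8563, 8573, 8581, 8597, 8599, 8609,
   8623, 8627, 8629, 8641, 8647, 8663, 8669, 8677, 8681, 8689, 8693, 8699, 8707, 8713, 8719, 8731],
  [8737, 8741, 8747, 8753, 8761, 8779, 8783, 8803, 8807, 8819, 8821, 8831, 8837, 8839, 8849, 8861,
   8863, 8867, 8887, 8893, 8923, 8929, 8933, 8941, 8951, 8963, 8969, 8971, 8999, 9001, 9007, 9011,
   9013, 9029, 9041, 9043, 9049, 9059, 9067, 9091, 9103, 9109, 9127, 9133, 9137, 9151, 9157, 9161,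
   9173, 9181, 9187, 9199, 9203, 9209, 9221, 9227, 9239, 9241, 9257, 9277, 9281, 9283, 9293, 9311],
  [9319, 9323, 9337, 9341, 9343, 9349, 9371, 9377, 9391, 9397, 9403, 9413, 9419, 9421, 9431, 9433,
   9437, 9439, 9461, 9463, 9467, 9473, 9479, 9491, 9497, 9511, 9521, 9533, 9539, 9547, 9551, 9587,
   9601, 9613, 9619, 9623, 9629, 9631, 9643, 9649, 9661, 9677, 9679, 9689, 9697, 9719, 9721, 9733,
   9739, 9743, 9749, 9767, 9769, 9781, 9787, 9791, 9803, 9811, 9817, 9829, 9833, 9839, 9851, 9857],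
  [9859, 9871, 9883, 9887, 9901, 9907, 9923, 9929, 9931, 9941, 9949, 9967, 9973, 10007, 10009, 10037,
   10039, 10061, 10067, 10069, 10079, 10091, 10093, 10099, 10103, 10111, 10133, 10139, 10141, 10151, 10159, 10163,
   10169, 10177, 10181, 10193, 10211, 10223, 10243, 10247, 10253, 10259, 10267, 10271, 10273, 10289, 10301, 10303,
   10313, 10321, 10331, 10333, 10337, 10343, 10357, 10369, 10391, 10399, 10427, 10429, 10433, 10453, 10457, 10459],
  [10463, 10477, 10487, 10499, 10501, 10513, 10529, 10531, 10559, 10567, 10589, 10597, 10601, 10607, 10613, 10627,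
   10631, 10639, 10651, 10657, 10663, 10667, 10687, 10691, 10709, 10711, 10723, 10729, 10733, 10739, 10753, 10771,
   10781, 10789, 10799, 10831, 10837, 10847, 10853, 10859, 10861, 10867, 10883, 10889, 10891, 10903, 10909, 10937,
   10939, 10949, 10957, 10973, 10979, 10987, 10993, 11003, 11027, 11047, 11057, 11059, 11069, 11071, 11083, 11087],
  [11093, 11113, 11117, 11119, 11131, 11149, 11159, 11161, 11171, 11173, 11177, 11197, 11213, 11239, 11243, 11251,
   11257, 11261, 11273, 11279, 11287, 11299, 11311, 11317, 11321, 11329, 11351, 11353, 11369, 11383, 11393, 11399,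
   11411, 11423, 11437, 11443, 11447, 11467, 11471, 11483, 11489, 11491, 11497, 11503, 11519, 11527, 11549, 11551,
   11579, 11587, 11593, 11597, 11617, 11621, 11633, 11657, 11677, 11681, 11689, 11699, 11701, 11717, 11719, 11731],
  [11743, 11777, 11779, 11783, 11789, 11801, 11807, 11813, 11821, 11827, 11831, 11833, 11839, 11863, 11867, 11887,
   11897, 11903, 11909, 11923, 11927, 11933, 11939, 11941, 11953, 11959, 11969, 11971, 11981, 11987, 12007, 12011,
   12037, 12041, 12043, 12049, 12071, 12073, 12097, 12101, 12107, 12109, 12113, 12119, 12143, 12149, 12157, 12161,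
   12163, 12197, 12203, 12211, 12227, 12239, 12241, 12251, 12253, 12263, 12269, 12277, 12281, 12289, 12301, 12323],
  [12329, 12343, 12347, 12373, 12377, 12379, 12391, 12401, 12409, 12413, 12421, 12433, 12437, 12451, 12457, 12473,
   12479, 12487, 12491, 12497, 12503, 12511, 12517, 12527, 12539, 12541, 12547, 12553, 12569, 12577, 12583, 12589,
   12601, 12611, 12613, 12619, 12637, 12641, 12647, 12653, 12659, 12671, 12689, 12697, 12703, 12713, 12721, 12739,
   12743, 12757, 12763, 12781, 12791, 12799, 12809, 12821, 12823, 12829, 12841, 12853, 12889, 12893, 12899, 12907],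
  [12911, 12917, 12919, 12923, 12941, 12953, 12959, 12967, 12973, 12979, 12983, 13001, 13003, 13007, 13009, 13033,
   13037, 13043, 13049, 13063, 13093, 13099, 13103, 13109, 13121, 13127, 13147, 13151, 13159, 13163, 13171, 13177,
   13183, 13187, 13217, 13219, 13229, 13241, 13249, 13259, 13267, 13291, 13297, 13309, 13313, 13327, 13331, 13337,
   13339, 13367, 13381, 13397, 13399, 13411, 13417, 13421, 13441, 13451, 13457, 13463, 13469, 13477, 13487, 13499],
  [13513, 13523, 13537, 13553, 13567, 13577, 13591, 13597, 13613, 13619, 13627, 13633, 13649, 13669, 13679, 13681,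
   13687, 13691, 13693, 13697, 13709, 13711, 13721, 13723, 13729, 13751, 13757, 13759, 13763, 13781, 13789, 13799,
   13807, 13829, 13831, 13841, 13859, 13873, 13877, 13879, 13883, 13901, 13903, 13907, 13913, 13921, 13931, 13933,
   13963, 13967, 13997, 13999, 14009, 14011, 14029, 14033, 14051, 14057, 14071, 14081, 14083, 14087, 14107, 14143],
  [14149, 14153, 14159, 14173, 14177, 14197, 14207, 14221, 14243, 14249, 14251, 14281, 14293, 14303, 14321, 14323,
   14327, 14341, 14347, 14369, 14387, 14389, 14401, 14407, 14411, 14419, 14423, 14431, 14437, 14447, 14449, 14461,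
   14479, 14489, 14503, 14519, 14533, 14537, 14543, 14549, 14551, 14557, 14561, 14563, 14591, 14593, 14621, 14627,
   14629, 14633, 14639, 14653, 14657, 14669, 14683, 14699, 14713, 14717, 14723, 14731, 14737, 14741, 14747, 14753],
  [14759, 14767, 14771, 14779, 14783, 14797, 14813, 14821, 14827, 14831, 14843, 14851, 14867, 14869, 14879]]

/-- All primes up to 14880. -/
def primeList : List ℕ := primeLists.flatten

/-- No run of eleven numbers divisible by squares starts in `[lo, lo + len)`. -/
noncomputable def segCheck (lo len : ℕ) : Bool :=
  Nat.beq (Nat.mod (runs (sieveAll lo (Nat.add len 10) primeLists)) (Nat.pow 2 len)) 0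

theorem rep_spec (len s : ℕ) (fuel : ℕ) : ∀ h w, s ∣ w → len ≤ 2 ^ fuel * w →
    (∀ q, s * q < w → h.testBit (s * q) = true) →
    ∀ q, s * q < len → (rep len fuel h w).testBit (s * q) = true := by
  induction fuel with
  | zero =>
    intro h w _ hl hh q hq
    exact hh q (by omega)
  | succ k ih =>
    intro h w hd hl hh q hq
    have hrep : rep len (k+1) h w = bif Nat.ble len w then h
        else rep len k (h ||| (h <<< w)) (w + w) := by
      show (Bool.rec (force (Nat.lor h (Nat.shiftLeft h w)) (fun h' => rep len k h' (Nat.add w w)))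
        h (Nat.ble len w) : ℕ) = _
      rw [force_eq]
      cases Nat.ble len w <;> rfl
    rw [hrep]
    cases hb : Nat.ble len w with
    | true =>
      have := Nat.le_of_ble_eq_true hb
      exact hh q (by omega)
    | false =>
      refine ih _ _ (Dvd.dvd.add hd hd) (by rw [pow_succ] at hl; linarith) ?_ q hq
      intro q hq
      rw [Nat.testBit_or, Nat.testBit_shiftLeft]
      by_cases h1 : s * q < w
      · simp [hh q h1]
      · obtain ⟨c, rfl⟩ := hd
        have h2 : s * q - s * c = s * (q - c) := (Nat.mul_sub s q c).symm
        have h3 := hh (q - c) (by omega)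
        rw [h2, h3]
        simp
        right; omega

theorem off_spec (lo s j : ℕ) (hs : 0 < s) (h : s ∣ lo + j) :
    ∃ q, j = off lo s + s * q := by
  have hoff : off lo s = (s - lo % s) % s := rfl
  have h1 : off lo s ≡ j [MOD s] := by
    have hlt := Nat.mod_lt lo hs
    rw [hoff]
    refine (Nat.mod_modEq _ _).trans ?_
    apply Nat.ModEq.add_left_cancel (Nat.mod_modEq lo s)
    have e : lo % s + (s - lo % s) = s := by omega
    rw [e]
    exact (Nat.modEq_zero_iff_dvd.2 dvd_rfl).trans (Nat.modEq_zero_iff_dvd.2 h).symm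
  have hlt : off lo s < s := Nat.mod_lt _ hs
  refine ⟨j / s, ?_⟩
  have h2 : off lo s = j % s := by
    have := h1
    unfold Nat.ModEq at this
    rwa [Nat.mod_eq_of_lt hlt] at this
  rw [h2, Nat.mod_add_div]

theorem sieve_spec (lo len p j : ℕ) (hlen : len ≤ 2 ^ 24) (hp : 0 < p) (hj : j < len)
    (hd : p * p ∣ lo + j) (l : List ℕ) (hl : p ∈ l) : (sieve lo len l).testBit j = true := by
  induction l with
  | nil => simp at hl
  | cons a l ih =>
    have hsv : sieve lo len (a :: l) = bif Nat.blt (off lo (a * a)) len then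
        ((rep len 24 1 (a * a)) <<< off lo (a * a)) ||| sieve lo len l else sieve lo len l := by
      show (Bool.rec (sieve lo len l) (Nat.lor (Nat.shiftLeft (rep len 24 1 (Nat.mul a a))
        (off lo (Nat.mul a a))) (sieve lo len l)) (Nat.blt (off lo (Nat.mul a a)) len) : ℕ) = _
      show _ = bif Nat.blt (off lo (Nat.mul a a)) len then _ else _
      cases Nat.blt (off lo (Nat.mul a a)) len <;> rfl
    rw [hsv]
    by_cases hpa : p = a
    · subst hpa
      have hs : 0 < p * p := Nat.mul_pos hp hp
      obtain ⟨q, hq⟩ := off_spec lo (p * p) j hs hd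
      have hb : Nat.blt (off lo (p * p)) len = true := by
        rw [Nat.blt_eq]; omega
      rw [hb, cond_true, Nat.testBit_or, Nat.testBit_shiftLeft]
      have h1 : j - off lo (p * p) = p * p * q := by omega
      have h2 : (rep len 24 1 (p * p)).testBit (p * p * q) = true := by
        apply rep_spec len (p * p) 24 1 (p * p) dvd_rfl
        · nlinarith
        · intro q hq
          have : q = 0 := by
            by_contra h
            have := Nat.le_mul_of_pos_right (p * p) (Nat.pos_of_ne_zero h)
            omega
          subst this
          simp
        · omega
      rw [h1, h2]
      simp
      left; omega
    · have hl' : p ∈ l := by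
        rcases List.mem_cons.1 hl with h | h
        · exact absurd h hpa
        · exact h
      have h3 := ih hl'
      cases Nat.blt (off lo (a * a)) len with
      | true => rw [cond_true, Nat.testBit_or, h3, Bool.or_true]
      | false => exact h3

theorem sieveAll_spec (lo len p j : ℕ) (hlen : len ≤ 2 ^ 24) (hp : 0 < p) (hj : j < len)
    (hd : p * p ∣ lo + j) (ll : List (List ℕ)) (hl : ∃ l ∈ ll, p ∈ l) :
    (sieveAll lo len ll).testBit j = true := by
  induction ll with
  | nil => simp at hl
  | cons a t ih =>
    have hsv : sieveAll lo len (a :: t) = sieve lo len a ||| sieveAll lo len t := rfl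
    rw [hsv, Nat.testBit_or]
    obtain ⟨l, hl, hpl⟩ := hl
    rcases List.mem_cons.1 hl with rfl | h
    · rw [sieve_spec lo len p j hlen hp hj hd l hpl, Bool.true_or]
    · rw [ih ⟨l, h, hpl⟩, Bool.or_true]

theorem runs_spec (S j : ℕ) (h : ∀ i < 11, S.testBit (j + i) = true) :
    (runs S).testBit j = true := by
  unfold runs
  simp only [force_eq]
  have hl : ∀ a b, Nat.land a b = a &&& b := fun _ _ => rfl
  have hr : ∀ a b, Nat.shiftRight a b = a >>> b := fun _ _ => rfl
  simp only [hl, hr, Nat.testBit_and, Nat.testBit_shiftRight, Bool.and_eq_true]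
  refine ⟨⟨⟨⟨?_, ?_⟩, ?_, ?_⟩, ⟨?_, ?_⟩, ?_, ?_⟩, ⟨⟨?_, ?_⟩, ?_, ?_⟩, ⟨?_, ?_⟩, ?_, ?_⟩
  all_goals
    first
    | exact h 0 (by norm_num)
    | (have h1 := h 1 (by norm_num)
       have h2 := h 2 (by norm_num)
       have h3 := h 3 (by norm_num)
       have h4 := h 4 (by norm_num)
       have h5 := h 5 (by norm_num)
       have h6 := h 6 (by norm_num)
       have h7 := h 7 (by norm_num)
       have h8 := h 8 (by norm_num)
       have h9 := h 9 (by norm_num)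
       have h10 := h 10 (by norm_num)
       ring_nf at *
       assumption)

theorem segCheck_spec (lo len N : ℕ) (hlen : len + 11 ≤ 2 ^ 24) (hc : segCheck lo len = true)
    (h1 : lo ≤ N) (h2 : N < lo + len)
    (h : ∀ i < 11, ∃ p ∈ primeList, 0 < p ∧ p * p ∣ N + i) : False := by
  have h0 : runs (sieveAll lo (len + 10) primeLists) % 2 ^ len = 0 := Nat.eq_of_beq_eq_true hc
  have hb : (runs (sieveAll lo (len + 10) primeLists)).testBit (N - lo) = true := by
    apply runs_spec
    intro i hi
    obtain ⟨p, hp, hp0, hd⟩ := h i hi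
    have e : lo + (N - lo + i) = N + i := by omega
    exact sieveAll_spec lo (len + 10) p (N - lo + i) (by omega) hp0 (by omega) (by rwa [e]) _
      (List.mem_flatten.1 hp)
  have h3 : (runs (sieveAll lo (len + 10) primeLists) % 2 ^ len).testBit (N - lo) = true := by
    rw [Nat.testBit_mod_two_pow, hb]
    simp
    omega
  rw [h0] at h3
  simp at h3

/-- Walk through `n, n+1, …` and check that non-members of the list have a small factor. -/
def allPrimes (Q : ℕ) : ℕ → ℕ → List ℕ → Bool :=
  fun fuel => Nat.rec (fun _ _ => true)
    (fun _ ih n l => List.rec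
      (Bool.rec (ih (Nat.succ n) []) false (Nat.beq (Nat.gcd n Q) 1))
      (fun a t _ => Bool.rec
        (Bool.rec (ih (Nat.succ n) (a :: t)) false (Nat.beq (Nat.gcd n Q) 1))
        (ih (Nat.succ n) t) (Nat.beq n a)) l) fuel

theorem allPrimes_spec (b : ℕ) (fuel : ℕ) : ∀ n l, allPrimes b.factorial fuel n l = true → b < n →
    ∀ p, n ≤ p → p < n + fuel → p.Prime → p ∈ l := by
  induction fuel with
  | zero => intro n l _ _ p h1 h2; omega
  | succ k ih =>
    intro n l hc hb p h1 h2 hp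
    have key : p = n → Nat.beq (Nat.gcd n b.factorial) 1 = true := by
      rintro rfl
      have : Nat.Coprime p b.factorial := by
        rw [Nat.Prime.coprime_iff_not_dvd hp, hp.dvd_factorial]
        omega
      rw [Nat.beq_eq]; exact this
    cases l with
    | nil =>
      have hc' : (Bool.rec (allPrimes b.factorial k (n+1) []) false
        (Nat.beq (Nat.gcd n b.factorial) 1) : Bool) = true := hc
      by_cases hpn : p = n
      · rw [key hpn] at hc'; simp at hc'
      · cases hg : Nat.beq (Nat.gcd n b.factorial) 1 with
        | true => rw [hg] at hc'; simp at hc'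
        | false =>
          rw [hg] at hc'
          exact ih _ _ hc' (by omega) p (by omega) (by omega) hp
    | cons a t =>
      have hc' : (Bool.rec (Bool.rec (allPrimes b.factorial k (n+1) (a :: t)) false
        (Nat.beq (Nat.gcd n b.factorial) 1)) (allPrimes b.factorial k (n+1) t)
        (Nat.beq n a) : Bool) = true := hc
      cases hna : Nat.beq n a with
      | true =>
        rw [hna] at hc'
        have := Nat.eq_of_beq_eq_true hna
        by_cases hpn : p = n
        · simp [hpn, this]
        · exact List.mem_cons_of_mem _ (ih _ _ hc' (by omega) p (by omega) (by omega) hp)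
      | false =>
        rw [hna] at hc'
        by_cases hpn : p = n
        · rw [key hpn] at hc'; simp at hc'
        · cases hg : Nat.beq (Nat.gcd n b.factorial) 1 with
          | true => rw [hg] at hc'; simp at hc'
          | false =>
            rw [hg] at hc'
            exact ih _ _ hc' (by omega) p (by omega) (by omega) hp

theorem primes_small : ∀ p < 128, p.Prime → p ∈ primeList.take 31 := by decide +kernel

theorem primes_large : ∀ c < 50, allPrimes (Nat.factorial 127) 295 (128 + 295 * c)
    (primeList.dropWhile (fun p => Nat.blt p (128 + 295 * c))) = true := by decide +kernel

theorem mem_primeList (p : ℕ) (hp : p.Prime) (h : p < 14878) : p ∈ primeList := by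
  rcases lt_or_ge p 128 with h1 | h1
  · exact List.mem_of_mem_take (primes_small p h1 hp)
  · have hc : (p - 128) / 295 < 50 := by omega
    exact (List.dropWhile_sublist _).subset
      (allPrimes_spec 127 295 (128 + 295 * ((p - 128) / 295)) _ (primes_large _ hc) (by omega) p
        (by omega) (by omega) hp)

/-- Check `m` consecutive segments of length `len`, starting with the segment of index `t`. -/
noncomputable def groupCheck (len t m : ℕ) : Bool :=
  Nat.rec true (fun k ih => Bool.rec false ih (segCheck (Nat.mul (Nat.add t k) len) len)) m

theorem groupCheck_spec (len t m : ℕ) (h : groupCheck len t m = true) :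
    ∀ k < m, segCheck ((t + k) * len) len = true := by
  induction m with
  | zero => intro k hk; omega
  | succ m ih =>
    have h' : (Bool.rec false (groupCheck len t m) (segCheck ((t + m) * len) len) : Bool) = true := h
    cases hs : segCheck ((t + m) * len) len with
    | false => rw [hs] at h'; simp at h'
    | true =>
      rw [hs] at h'
      intro k hk
      rcases Nat.lt_succ_iff_lt_or_eq.1 hk with h1 | h1
      · exact ih h' k h1
      · rw [h1]; exact hs

theorem last_seg : segCheck 221167104 318 = true := by decide +kernel
theorem group_0 : groupCheck 431967 0 16 = true := by decide +kernel
theorem group_1 : groupCheck 431967 16 16 = true := by decide +kernel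
theorem group_2 : groupCheck 431967 32 16 = true := by decide +kernel
theorem group_3 : groupCheck 431967 48 16 = true := by decide +kernel
theorem group_4 : groupCheck 431967 64 16 = true := by decide +kernel
theorem group_5 : groupCheck 431967 80 16 = true := by decide +kernel
theorem group_6 : groupCheck 431967 96 16 = true := by decide +kernel
theorem group_7 : groupCheck 431967 112 16 = true := by decide +kernel
theorem group_8 : groupCheck 431967 128 16 = true := by decide +kernel
theorem group_9 : groupCheck 431967 144 16 = true := by decide +kernel
theorem group_10 : groupCheck 431967 160 16 = true := by decide +kernel
theorem group_11 : groupCheck 431967 176 16 = true := by decide +kernel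
theorem group_12 : groupCheck 431967 192 16 = true := by decide +kernel
theorem group_13 : groupCheck 431967 208 16 = true := by decide +kernel
theorem group_14 : groupCheck 431967 224 16 = true := by decide +kernel
theorem group_15 : groupCheck 431967 240 16 = true := by decide +kernel
theorem group_16 : groupCheck 431967 256 16 = true := by decide +kernel
theorem group_17 : groupCheck 431967 272 16 = true := by decide +kernel
theorem group_18 : groupCheck 431967 288 16 = true := by decide +kernel
theorem group_19 : groupCheck 431967 304 16 = true := by decide +kernel
theorem group_20 : groupCheck 431967 320 16 = true := by decide +kernel
theorem group_21 : groupCheck 431967 336 16 = true := by decide +kernel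
theorem group_22 : groupCheck 431967 352 16 = true := by decide +kernel
theorem group_23 : groupCheck 431967 368 16 = true := by decide +kernel
theorem group_24 : groupCheck 431967 384 16 = true := by decide +kernel
theorem group_25 : groupCheck 431967 400 16 = true := by decide +kernel
theorem group_26 : groupCheck 431967 416 16 = true := by decide +kernel
theorem group_27 : groupCheck 431967 432 16 = true := by decide +kernel
theorem group_28 : groupCheck 431967 448 16 = true := by decide +kernel
theorem group_29 : groupCheck 431967 464 16 = true := by decide +kernel
theorem group_30 : groupCheck 431967 480 16 = true := by decide +kernel
theorem group_31 : groupCheck 431967 496 16 = true := by decide +kernel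

theorem groups (t : ℕ) (ht : t < 32) : groupCheck 431967 (t * 16) 16 = true := by
  interval_cases t
  · exact group_0
  · exact group_1
  · exact group_2
  · exact group_3
  · exact group_4
  · exact group_5
  · exact group_6
  · exact group_7
  · exact group_8
  · exact group_9
  · exact group_10
  · exact group_11
  · exact group_12
  · exact group_13
  · exact group_14
  · exact group_15
  · exact group_16
  · exact group_17
  · exact group_18
  · exact group_19
  · exact group_20
  · exact group_21
  · exact group_22
  · exact group_23
  · exact group_24
  · exact group_25
  · exact group_26
  · exact group_27
  · exact group_28
  · exact group_29
  · exact group_30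
  · exact group_31

theorem seg_cover (N : ℕ) (h : N < 221167422) :
    ∃ lo len, lo ≤ N ∧ N < lo + len ∧ len + 11 ≤ 2 ^ 24 ∧ segCheck lo len = true := by
  rcases lt_or_ge N 221167104 with h1 | h1
  · refine ⟨(N / 6911472 * 16 + N % 6911472 / 431967) * 431967, 431967, by omega, by omega, by norm_num, ?_⟩
    exact groupCheck_spec 431967 _ 16 (groups (N / 6911472) (by omega)) (N % 6911472 / 431967) (by omega)
  · exact ⟨221167104, 318, by omega, by omega, by norm_num, last_seg⟩

theorem exists_mem (n : ℕ) (h0 : 0 < n) (hn : n < 221200000) (h : ¬ Squarefree n) :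
    ∃ p ∈ primeList, 0 < p ∧ p * p ∣ n := by
  rw [Nat.squarefree_iff_prime_squarefree] at h
  push Not at h
  obtain ⟨p, hp, hd⟩ := h
  refine ⟨p, mem_primeList p hp ?_, hp.pos, hd⟩
  have := Nat.le_of_dvd h0 hd
  nlinarith

theorem squarefree_of_check (n : ℕ) (h0 : 0 < n) (hn : n < 221200000)
    (h : primeList.all (fun p => !(Nat.beq (Nat.mod n (Nat.mul p p)) 0)) = true) :
    Squarefree n := by
  by_contra hs
  obtain ⟨p, hp, _, hd⟩ := exists_mem n h0 hn hs
  have h1 := List.all_eq_true.1 h p hp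
  have h2 : Nat.beq (Nat.mod n (Nat.mul p p)) 0 = true := by
    rw [Nat.beq_eq]; exact Nat.mod_eq_zero_of_dvd hd
  rw [h2] at h1
  simp at h1

theorem not_squarefree_of (n p : ℕ) (hp : 1 < p) (h : p * p ∣ n) : ¬ Squarefree n := by
  intro hs
  have := Nat.isUnit_iff.1 (hs p h)
  omega

/-- Qgap(11) = 221167422. -/
theorem qgap_11 : IsLeast {N : ℕ | StartsSquarefreeGap N 11} 221167422 := by
  constructor
  · refine ⟨by norm_num, by norm_num, ?_, ?_, ?_⟩
    · have hw : ∀ i < 11, ∃ p ∈ primeList.take 100, 1 < p ∧ p * p ∣ 221167422 + i := by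
        decide +kernel
      intro i hi
      obtain ⟨p, _, h1, h2⟩ := hw i hi
      exact not_squarefree_of _ p h1 h2
    · exact squarefree_of_check _ (by norm_num) (by norm_num) (by decide +kernel)
    · exact squarefree_of_check _ (by norm_num) (by norm_num) (by decide +kernel)
  · intro N hN
    obtain ⟨h2, _, hall, _, _⟩ := hN
    by_contra hlt
    have hlt' : N < 221167422 := by omega
    obtain ⟨lo, len, ha, hb, hl, hc⟩ := seg_cover N hlt'
    exact segCheck_spec lo len N hl hc ha hb
      (fun i hi => exists_mem (N + i) (by omega) (by omega) (hall i hi))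
end
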